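/- For any four random variables A, X, Y, Z, the following identity between entropic quantities holds: I(Y:Z|A) + I(Y:Z|X) + I(A:X) − I(Y:Z) = I(Y:X|Z) + I(X:A|Y) + I(Y:Z|AX) − I(X:Y|AZ). Consequently, if I(X:Y|AZ) = 0 then the Ingleton quantity satisfies I_ING(Y,Z;A,X) ≥ 0. -/

import Mathlib

open Finset
open scoped Classical

/-- Probability that the random variable `X` (on the finite weighted sample space
`(Ω, μ)`) takes the value `b`. -/
noncomputable def pr {Ω β : Type*} [Fintype Ω] (μ : Ω → ℝ) (X : Ω → β) (b : β) : ℝ :=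
  ∑ ω, if X ω = b then μ ω else 0

/-- Shannon entropy of the random variable `X` on the finite weighted sample space
`(Ω, μ)`. -/
noncomputable def ent {Ω β : Type*} [Fintype Ω] [Fintype β] (μ : Ω → ℝ) (X : Ω → β) : ℝ :=
  ∑ b, Real.negMulLog (pr μ X b)

/-- Mutual information `I(X : Y)`. -/
noncomputable def mi {Ω β γ : Type*} [Fintype Ω] [Fintype β] [Fintype γ]
    (μ : Ω → ℝ) (X : Ω → β) (Y : Ω → γ) : ℝ :=
  ent μ X + ent μ Y - ent μ (fun ω => (X ω, Y ω))

/-- Conditional mutual information `I(X : Y | Z)`. -/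
noncomputable def cmi {Ω β γ δ : Type*} [Fintype Ω] [Fintype β] [Fintype γ] [Fintype δ]
    (μ : Ω → ℝ) (X : Ω → β) (Y : Ω → γ) (Z : Ω → δ) : ℝ :=
  ent μ (fun ω => (X ω, Z ω)) + ent μ (fun ω => (Y ω, Z ω)) - ent μ Z
    - ent μ (fun ω => (X ω, Y ω, Z ω))

/-- The Ingleton quantity `I_ING(S,T;U,V)`. -/
noncomputable def ing {Ω β γ δ ε : Type*} [Fintype Ω] [Fintype β] [Fintype γ] [Fintype δ]
    [Fintype ε] (μ : Ω → ℝ) (S : Ω → β) (T : Ω → γ) (U : Ω → δ) (V : Ω → ε) : ℝ :=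
  cmi μ S T U + cmi μ S T V + mi μ U V - mi μ S T

theorem pr_nonneg {Ω β : Type*} [Fintype Ω] {μ : Ω → ℝ} (hμ0 : ∀ ω, 0 ≤ μ ω)
    (X : Ω → β) (b : β) : 0 ≤ pr μ X b :=
  Finset.sum_nonneg fun ω _ => by split_ifs <;> simp [hμ0]

theorem pr_self_pos {Ω β : Type*} [Fintype Ω] {μ : Ω → ℝ} (hμ0 : ∀ ω, 0 ≤ μ ω)
    (X : Ω → β) {ω : Ω} (hω : 0 < μ ω) : 0 < pr μ X (X ω) := by
  refine Finset.sum_pos' (fun ω' _ => ?_) ⟨ω, mem_univ ω, by simpa using hω⟩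
  split_ifs <;> simp [hμ0]

/-- The expectation of `g ∘ X` computed from the distribution of `X`. -/
theorem sum_pr_mul {Ω β : Type*} [Fintype Ω] [Fintype β] (μ : Ω → ℝ) (X : Ω → β) (g : β → ℝ) :
    ∑ b, pr μ X b * g b = ∑ ω, μ ω * g (X ω) := by
  simp only [pr, sum_mul, ite_mul, zero_mul]
  rw [sum_comm]
  simp

theorem sum_pr {Ω β : Type*} [Fintype Ω] [Fintype β] (μ : Ω → ℝ) (X : Ω → β) :
    ∑ b, pr μ X b = ∑ ω, μ ω := by
  simpa using sum_pr_mul μ X fun _ => 1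

/-- Marginalising the first component of a pair. -/
theorem sum_pr_prodMk {Ω β γ : Type*} [Fintype Ω] [Fintype β] (μ : Ω → ℝ) (X : Ω → β)
    (Z : Ω → γ) (z : γ) : ∑ x, pr μ (fun ω => (X ω, Z ω)) (x, z) = pr μ Z z := by
  simp only [pr, Prod.mk.injEq, ite_and]
  rw [sum_comm]
  simp

theorem ent_eq_sum {Ω β : Type*} [Fintype Ω] [Fintype β] (μ : Ω → ℝ) (X : Ω → β) :
    ent μ X = ∑ ω, μ ω * -Real.log (pr μ X (X ω)) := by
  rw [← sum_pr_mul μ X fun b => -Real.log (pr μ X b)]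
  simp [ent, Real.negMulLog]

/-- Two random variables that determine each other have the same entropy. -/
theorem ent_congr {Ω β γ : Type*} [Fintype Ω] [Fintype β] [Fintype γ] (μ : Ω → ℝ)
    {X : Ω → β} {Y : Ω → γ} (h : ∀ ω ω', X ω' = X ω ↔ Y ω' = Y ω) : ent μ X = ent μ Y := by
  simp only [ent_eq_sum, pr, h]

/-- Conditional mutual information is nonnegative. -/
theorem cmi_nonneg {Ω β γ δ : Type*} [Fintype Ω] [Fintype β] [Fintype γ] [Fintype δ]
    {μ : Ω → ℝ} (hμ0 : ∀ ω, 0 ≤ μ ω) (X : Ω → β) (Y : Ω → γ) (Z : Ω → δ) :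
    0 ≤ cmi μ X Y Z := by
  set p := pr μ fun ω => (X ω, Y ω, Z ω)
  set q := pr μ fun ω => (X ω, Z ω)
  set r := pr μ fun ω => (Y ω, Z ω)
  set s := pr μ Z
  have hq : ∀ b, 0 ≤ q b := pr_nonneg hμ0 _
  have hr : ∀ b, 0 ≤ r b := pr_nonneg hμ0 _
  have hs : ∀ b, 0 ≤ s b := pr_nonneg hμ0 _
  let g : β × γ × δ → ℝ := fun w => q (w.1, w.2.2) * r w.2 / (s w.2.2 * p w)
  have hg : ∑ ω, μ ω * g (X ω, Y ω, Z ω) ≤ ∑ ω, μ ω := by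
    calc ∑ ω, μ ω * g (X ω, Y ω, Z ω)
        = ∑ w, p w * g w := (sum_pr_mul μ (fun ω => (X ω, Y ω, Z ω)) g).symm
      _ ≤ ∑ w : β × γ × δ, q (w.1, w.2.2) * r w.2 / s w.2.2 := by
          refine sum_le_sum fun w _ => ?_
          rcases eq_or_ne (p w) 0 with h | h
          · rw [h, zero_mul]
            exact div_nonneg (mul_nonneg (hq _) (hr _)) (hs _)
          · refine le_of_eq ?_
            simp only [g]
            rw [← div_div, mul_div_cancel₀ _ h]
      _ = ∑ z, (∑ x, q (x, z)) * (∑ y, r (y, z)) / s z := by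
          simp only [Fintype.sum_prod_type, sum_mul_sum, sum_div]
          rw [sum_congr rfl fun x _ => sum_comm, sum_comm]
      _ = ∑ z, s z := by
          refine sum_congr rfl fun z _ => ?_
          simp only [q, r, sum_pr_prodMk]
          exact mul_self_div_self _
      _ = ∑ ω, μ ω := sum_pr μ Z
  have hlog : ∑ ω, μ ω * (1 - g (X ω, Y ω, Z ω)) ≤ cmi μ X Y Z := by
    simp only [cmi, ent_eq_sum, ← sum_add_distrib, ← sum_sub_distrib]
    refine sum_le_sum fun ω _ => ?_
    rcases (hμ0 ω).eq_or_lt with h | h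
    · simp [← h]
    · have hp' : 0 < p (X ω, Y ω, Z ω) := pr_self_pos hμ0 (fun ω => (X ω, Y ω, Z ω)) h
      have hq' : 0 < q (X ω, Z ω) := pr_self_pos hμ0 (fun ω => (X ω, Z ω)) h
      have hr' : 0 < r (Y ω, Z ω) := pr_self_pos hμ0 (fun ω => (Y ω, Z ω)) h
      have hs' : 0 < s (Z ω) := pr_self_pos hμ0 Z h
      have key := Real.log_le_sub_one_of_pos
        (show 0 < g (X ω, Y ω, Z ω) from div_pos (mul_pos hq' hr') (mul_pos hs' hp'))
      have hlg : Real.log (g (X ω, Y ω, Z ω)) = Real.log (q (X ω, Z ω)) + Real.log (r (Y ω, Z ω))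
          - (Real.log (s (Z ω)) + Real.log (p (X ω, Y ω, Z ω))) := by
        simp only [g]
        rw [Real.log_div (mul_pos hq' hr').ne' (mul_pos hs' hp').ne',
          Real.log_mul hq'.ne' hr'.ne', Real.log_mul hs'.ne' hp'.ne']
      rw [← mul_add, ← mul_sub, ← mul_sub]
      refine mul_le_mul_of_nonneg_left ?_ h.le
      linarith
  simp only [mul_sub, mul_one, sum_sub_distrib] at hlog
  linarith

/-- **An entropic identity for four random variables and its Ingleton consequence.**
For any four random variables `A, X, Y, Z` on a common finite probability space,
`I(Y:Z|A) + I(Y:Z|X) + I(A:X) − I(Y:Z)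
  = I(Y:X|Z) + I(X:A|Y) + I(Y:Z|AX) − I(X:Y|AZ)`,
and consequently `I(X:Y|AZ) = 0` implies `I_ING(Y,Z;A,X) ≥ 0`. -/
theorem ingleton_rewriting_identity {Ω α β γ δ : Type*} [Fintype Ω]
    [Fintype α] [Fintype β] [Fintype γ] [Fintype δ]
    (μ : Ω → ℝ) (hμ0 : ∀ ω, 0 ≤ μ ω) (hμ1 : ∑ ω, μ ω = 1)
    (A : Ω → α) (X : Ω → β) (Y : Ω → γ) (Z : Ω → δ) :
    (cmi μ Y Z A + cmi μ Y Z X + mi μ A X - mi μ Y Z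
      = cmi μ Y X Z + cmi μ X A Y + cmi μ Y Z (fun ω => (A ω, X ω))
        - cmi μ X Y (fun ω => (A ω, Z ω))) ∧
    (cmi μ X Y (fun ω => (A ω, Z ω)) = 0 → 0 ≤ ing μ Y Z A X) := by
  have identity : cmi μ Y Z A + cmi μ Y Z X + mi μ A X - mi μ Y Z
      = cmi μ Y X Z + cmi μ X A Y + cmi μ Y Z (fun ω => (A ω, X ω))
        - cmi μ X Y (fun ω => (A ω, Z ω)) := by
    have hAZ : ent μ (fun ω => (Z ω, A ω)) = ent μ (fun ω => (A ω, Z ω)) :=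
      ent_congr μ fun _ _ => by grind
    have hXZ : ent μ (fun ω => (Z ω, X ω)) = ent μ (fun ω => (X ω, Z ω)) :=
      ent_congr μ fun _ _ => by grind
    have hXY : ent μ (fun ω => (Y ω, X ω)) = ent μ (fun ω => (X ω, Y ω)) :=
      ent_congr μ fun _ _ => by grind
    have hAY : ent μ (fun ω => (Y ω, A ω)) = ent μ (fun ω => (A ω, Y ω)) :=
      ent_congr μ fun _ _ => by grind
    have hAYZ : ent μ (fun ω => (Y ω, Z ω, A ω)) = ent μ (fun ω => (Y ω, A ω, Z ω)) :=
      ent_congr μ fun _ _ => by grind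
    have hXYZ : ent μ (fun ω => (Y ω, Z ω, X ω)) = ent μ (fun ω => (Y ω, X ω, Z ω)) :=
      ent_congr μ fun _ _ => by grind
    have hAXY : ent μ (fun ω => (X ω, A ω, Y ω)) = ent μ (fun ω => (Y ω, A ω, X ω)) :=
      ent_congr μ fun _ _ => by grind
    have hAXZ : ent μ (fun ω => (X ω, A ω, Z ω)) = ent μ (fun ω => (Z ω, A ω, X ω)) :=
      ent_congr μ fun _ _ => by grind
    have hAXYZ : ent μ (fun ω => (X ω, Y ω, A ω, Z ω)) = ent μ (fun ω => (Y ω, Z ω, A ω, X ω)) :=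
      ent_congr μ fun _ _ => by grind
    simp only [cmi, mi]
    linarith
  refine ⟨identity, fun h => ?_⟩
  have hYX := cmi_nonneg hμ0 Y X Z
  have hXA := cmi_nonneg hμ0 X A Y
  have hYZ := cmi_nonneg hμ0 Y Z fun ω => (A ω, X ω)
  rw [ing, identity, h]
  linarith
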